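/- There exist absolute constants c₁, c₂ > 0 such that the following holds. Let d ≤ 3, η ∈ (0, 1/(4−d)), c_V = c₁(1+‖V‖_∞^{1/2})^{−1/2}, and let Ψ be a solution of (−Δ+V)Ψ = EΨ on 𝕋^d_L with ‖Ψ‖_{L²} = 1 and E ∈ [(2c_V/L)^{4/(1+dη)}, min(c_V^{4/(1+dη)}, c₂^{2/(dη)})], L sufficiently large. Suppose Ψ is localized with respect to some x₀ ∈ 𝕋^d_L with localization length ℓ_loc and algebraic decay δ(r) = C r^{−α} for constants C ≥ 1/2 and α > 0 (with δ restricted to [1,∞) taking values in [0,1/2]). Then ℓ_loc > c_V E^{−1/4+η(1−d/4)} · min(1, C^{−1/α} E^{−η+1/α}). In particular, if α > 4/(1+dη), then this lower bound tends to +∞ as E → 0⁺. -/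

import Mathlib

open MeasureTheory Real Filter

noncomputable section

/-- The `i`-th generator of the lattice `L·ℒ₀ = ℤ(L·e₁) ⊕ ℤ(L·γ₁·e₂) ⊕ ⋯ ⊕ ℤ(L·γ_{d-1}·e_d)`. -/
def latVec (d : ℕ) (L : ℝ) (γ : Fin d → ℝ) (i : Fin d) : EuclideanSpace ℝ (Fin d) :=
  EuclideanSpace.single i (L * γ i)

/-- `f : ℝ^d → α` is periodic with respect to the lattice `L·ℒ₀` (equivalently,
it descends to the torus `𝕋^d_L = ℝ^d / L·ℒ₀`). -/
def LatPeriodic {α : Type*} (d : ℕ) (L : ℝ) (γ : Fin d → ℝ)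
    (f : EuclideanSpace ℝ (Fin d) → α) : Prop :=
  ∀ (x : EuclideanSpace ℝ (Fin d)) (i : Fin d), f (x + latVec d L γ i) = f x

/-- A fundamental domain for the torus `𝕋^d_L = ℝ^d / L·ℒ₀`. -/
def fund (d : ℕ) (L : ℝ) (γ : Fin d → ℝ) : Set (EuclideanSpace ℝ (Fin d)) :=
  {x | ∀ i, x i ∈ Set.Ico (0 : ℝ) (L * γ i)}

/-- The quotient (torus) distance on `𝕋^d_L`, computed between representatives in `ℝ^d`. -/
def torusDist (d : ℕ) (L : ℝ) (γ : Fin d → ℝ)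
    (x y : EuclideanSpace ℝ (Fin d)) : ℝ :=
  ⨅ v : Fin d → ℤ, ‖x - y - ∑ i, (v i : ℝ) • latVec d L γ i‖

/-- The (periodized) open ball `B(x₀, ρ)` of the torus metric, as a subset of `ℝ^d`. -/
def torusBall (d : ℕ) (L : ℝ) (γ : Fin d → ℝ)
    (x₀ : EuclideanSpace ℝ (Fin d)) (ρ : ℝ) : Set (EuclideanSpace ℝ (Fin d)) :=
  {x | torusDist d L γ x x₀ < ρ}

/-- The Euclidean Laplacian `Δf = ∑ᵢ ∂²f/∂xᵢ²`. -/
def lap (d : ℕ) (f : EuclideanSpace ℝ (Fin d) → ℂ)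
    (x : EuclideanSpace ℝ (Fin d)) : ℂ :=
  ∑ i, fderiv ℝ (fun y => fderiv ℝ f y (EuclideanSpace.single i 1)) x
      (EuclideanSpace.single i 1)

/-- The squared norm of the gradient, `|∇f|² = ∑ᵢ |∂f/∂xᵢ|²`. -/
def gradSq (d : ℕ) (f : EuclideanSpace ℝ (Fin d) → ℂ)
    (x : EuclideanSpace ℝ (Fin d)) : ℝ :=
  ∑ i, ‖fderiv ℝ f x (EuclideanSpace.single i 1)‖ ^ 2

/-- An `L²`-normalized solution of the stationary Schrödinger equation
`(-Δ + V)Ψ = EΨ` on the torus `𝕋^d_L`. -/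
def IsSolution (d : ℕ) (L : ℝ) (γ : Fin d → ℝ)
    (V : EuclideanSpace ℝ (Fin d) → ℝ) (E : ℝ)
    (Ψ : EuclideanSpace ℝ (Fin d) → ℂ) : Prop :=
  ContDiff ℝ 2 Ψ ∧ LatPeriodic d L γ Ψ ∧
    (∀ x, -lap d Ψ x + (V x : ℂ) * Ψ x = (E : ℂ) * Ψ x) ∧
    (∫ x in fund d L γ, ‖Ψ x‖ ^ 2) = 1

/-- `r_d(n)`: the number of lattice points `ξ ∈ ℤ^d` with `|ξ|² = n`. -/
def rd (d n : ℕ) : ℕ := Nat.card {ξ : Fin d → ℤ // ∑ i, (ξ i) ^ 2 = (n : ℤ)}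

/-- The character `e(ξ·x/r') = e^{2πi ξ·x/r'}`. -/
def ec (d : ℕ) (r' : ℝ) (ξ : Fin d → ℤ) (x : EuclideanSpace ℝ (Fin d)) : ℂ :=
  Complex.exp (2 * Real.pi * Complex.I * (∑ i, (ξ i : ℂ) * (x i : ℂ)) / (r' : ℂ))

section helpers

variable {d : ℕ} {L : ℝ} {γ : Fin d → ℝ}

def latBasis (d : ℕ) (L : ℝ) (γ : Fin d → ℝ) (h : ∀ i, IsUnit (L * γ i)) :
    Module.Basis (Fin d) ℝ (EuclideanSpace ℝ (Fin d)) :=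
  (EuclideanSpace.basisFun (Fin d) ℝ).toBasis.isUnitSMul h

lemma latBasis_apply (h : ∀ i, IsUnit (L * γ i)) (i : Fin d) :
    latBasis d L γ h i = latVec d L γ i := by
  rw [latBasis, Module.Basis.isUnitSMul_apply]
  ext j
  simp [latVec]

lemma pos_of (hL : 0 < L) (hγ : ∀ i, 1 ≤ γ i) (i : Fin d) : 0 < L * γ i :=
  mul_pos hL (lt_of_lt_of_le one_pos (hγ i))

lemma fund_eq (hL : 0 < L) (hγ : ∀ i, 1 ≤ γ i) (h : ∀ i, IsUnit (L * γ i)) :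
    fund d L γ = ZSpan.fundamentalDomain (latBasis d L γ h) := by
  ext x
  simp only [fund, ZSpan.mem_fundamentalDomain, Set.mem_ofPred_eq]
  refine forall_congr' fun i => ?_
  have hp := pos_of hL hγ i
  rw [latBasis, Module.Basis.repr_isUnitSMul]
  have : ((h i).unit⁻¹ • ((EuclideanSpace.basisFun (Fin d) ℝ).toBasis.repr x) i : ℝ)
      = x i / (L * γ i) := by
    simp [Units.smul_def, div_eq_inv_mul]
  rw [this, Set.mem_Ico, Set.mem_Ico, div_lt_one hp]
  simp [div_nonneg_iff, hp.le, hp.not_ge]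

lemma hunit (hL : 0 < L) (hγ : ∀ i, 1 ≤ γ i) (i : Fin d) : IsUnit (L * γ i) :=
  (pos_of hL hγ i).ne'.isUnit

lemma fund_meas (hL : 0 < L) (hγ : ∀ i, 1 ≤ γ i) : MeasurableSet (fund d L γ) := by
  rw [fund_eq hL hγ (hunit hL hγ)]
  exact ZSpan.fundamentalDomain_measurableSet _

lemma fund_sub (hL : 0 < L) (hγ : ∀ i, 1 ≤ γ i) :
    ∃ K : Set (EuclideanSpace ℝ (Fin d)), IsCompact K ∧ fund d L γ ⊆ K := by
  rw [fund_eq hL hγ (hunit hL hγ)]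
  exact ⟨_, (ZSpan.fundamentalDomain_isBounded (latBasis d L γ (hunit hL hγ))).isCompact_closure,
    subset_closure⟩

lemma cont_int (hL : 0 < L) (hγ : ∀ i, 1 ≤ γ i) {F : Type*} [NormedAddCommGroup F]
    {f : EuclideanSpace ℝ (Fin d) → F}
    (hf : Continuous f) : IntegrableOn f (fund d L γ) := by
  obtain ⟨K, hK, hs⟩ := fund_sub hL hγ
  exact (hf.continuousOn.integrableOn_compact hK).mono_set hs

lemma per_span (hL : 0 < L) (hγ : ∀ i, 1 ≤ γ i) {F : Type*}
    {f : EuclideanSpace ℝ (Fin d) → F} (hf : LatPeriodic d L γ f)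
    {v : EuclideanSpace ℝ (Fin d)}
    (hv : v ∈ Submodule.span ℤ (Set.range (latBasis d L γ (hunit hL hγ)))) :
    ∀ x, f (v + x) = f x := by
  let S : AddSubgroup (EuclideanSpace ℝ (Fin d)) :=
    { carrier := {v | ∀ x, f (v + x) = f x}
      zero_mem' := by simp
      add_mem' := by
        intro a b ha hb x
        rw [add_assoc, ha, hb]
      neg_mem' := by
        intro a ha x
        rw [← ha (-a + x), add_neg_cancel_left] }
  have : Submodule.span ℤ (Set.range (latBasis d L γ (hunit hL hγ))) ≤
      AddSubgroup.toIntSubmodule S := by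
    rw [Submodule.span_le]
    rintro _ ⟨i, rfl⟩
    intro x
    rw [latBasis_apply, add_comm]
    exact hf x i
  exact this hv

lemma int_translate (hL : 0 < L) (hγ : ∀ i, 1 ≤ γ i) 
    {f : EuclideanSpace ℝ (Fin d) → ℝ} (hf : LatPeriodic d L γ f)
    (h : EuclideanSpace ℝ (Fin d)) :
    ∫ x in fund d L γ, f (x + h) = ∫ x in fund d L γ, f x := by
  have hfd := ZSpan.isAddFundamentalDomain (latBasis d L γ (hunit hL hγ)) volume
  rw [← fund_eq hL hγ] at hfd
  have h2 : IsAddFundamentalDomain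
      (Submodule.span ℤ (Set.range (latBasis d L γ (hunit hL hγ))))
      ((fun x => x + (-h)) ⁻¹' (fund d L γ)) (volume : Measure (EuclideanSpace ℝ (Fin d))) := by
    refine hfd.preimage_of_equiv (measurePreserving_add_right _ _).quasiMeasurePreserving
      Function.bijective_id ?_
    intro g x
    simp [Submodule.vadd_def, add_assoc]
  have : Countable (Submodule.span ℤ (Set.range (latBasis d L γ (hunit hL hγ)))) := inferInstance
  have : VAddInvariantMeasure (Submodule.span ℤ (Set.range (latBasis d L γ (hunit hL hγ))))
      (EuclideanSpace ℝ (Fin d)) volume :=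
    inferInstanceAs <| VAddInvariantMeasure
      (Submodule.span ℤ (Set.range (latBasis d L γ (hunit hL hγ)))).toAddSubgroup _ volume
  have : MeasurableConstVAdd (Submodule.span ℤ (Set.range (latBasis d L γ (hunit hL hγ))))
      (EuclideanSpace ℝ (Fin d)) :=
    inferInstanceAs <| MeasurableConstVAdd
      (Submodule.span ℤ (Set.range (latBasis d L γ (hunit hL hγ)))).toAddSubgroup _ 
  rw [hfd.setIntegral_eq h2 (f := f) (fun g x => per_span hL hγ hf g.2 x)]
  rw [← (measurePreserving_add_right volume h).setIntegral_preimage_emb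
    (measurableEmbedding_addRight h) f ((fun x => x + (-h)) ⁻¹' (fund d L γ))]
  rw [Set.preimage_preimage]
  simp only [add_neg_cancel_right, Set.preimage_id']

lemma fub (hL : 0 < L) (hγ : ∀ i, 1 ≤ γ i)
    {g : EuclideanSpace ℝ (Fin d) → ℝ} (hg : Continuous g) (hp : LatPeriodic d L γ g)
    (e : EuclideanSpace ℝ (Fin d)) (h : ℝ) :
    ∫ x in fund d L γ, ∫ s in (0:ℝ)..h, g (x + s • e) = h * ∫ x in fund d L γ, g x := by
  rw [← intervalIntegral_integral_swap (f := fun s x => g (x + s • e))]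
  · simp_rw [int_translate hL hγ hp]
    simp
  · obtain ⟨K, hK, hs⟩ := fund_sub hL hγ
    rw [Measure.prod_restrict]
    have hc : Continuous (Function.uncurry fun (s : ℝ) (x : EuclideanSpace ℝ (Fin d)) =>
        g (x + s • e)) := by
      unfold Function.uncurry; fun_prop
    have := hc.continuousOn.integrableOn_compact (μ := volume.prod volume)
      ((isCompact_uIcc (a := 0) (b := h)).prod hK)
    exact this.mono_set (Set.prod_mono Set.uIoc_subset_uIcc hs)

lemma int_deriv (hL : 0 < L) (hγ : ∀ i, 1 ≤ γ i)
    {F : EuclideanSpace ℝ (Fin d) → ℝ} (hF : ContDiff ℝ 1 F) (hp : LatPeriodic d L γ F)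
    (e : EuclideanSpace ℝ (Fin d)) (hp' : LatPeriodic d L γ (fun x => fderiv ℝ F x e)) :
    ∫ x in fund d L γ, fderiv ℝ F x e = 0 := by
  have hc : Continuous (fun x => fderiv ℝ F x e) :=
    (hF.continuous_fderiv (by norm_num)).clm_apply continuous_const
  have h1 := fub hL hγ hc hp' e 1
  rw [one_mul] at h1
  rw [← h1]
  have h2 : ∀ x, ∫ s in (0:ℝ)..1, fderiv ℝ F (x + s • e) e = F (x + e) - F x := by
    intro x
    have := intervalIntegral.integral_eq_sub_of_hasDerivAt (a := 0) (b := 1)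
      (f := fun s : ℝ => F (x + s • e)) (f' := fun s => fderiv ℝ F (x + s • e) e) ?_ ?_
    · simpa using this
    · intro s _
      have h3 : HasDerivAt (fun s : ℝ => x + s • e) e s := by
        simpa using ((hasDerivAt_id s).smul_const e).const_add x
      exact ((hF.differentiable (by norm_num)) _).hasFDerivAt.comp_hasDerivAt s h3
    · exact (hc.comp (by fun_prop : Continuous fun s : ℝ => x + s • e)).intervalIntegrable _ _
  simp_rw [h2]
  rw [integral_sub, int_translate hL hγ hp, sub_self]
  · exact cont_int hL hγ (hF.continuous.comp (by fun_prop : Continuous fun x => x + e))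
  · exact cont_int hL hγ hF.continuous

lemma per_fderiv {F : Type*} [NormedAddCommGroup F] [NormedSpace ℝ F]
    {f : EuclideanSpace ℝ (Fin d) → F} (hf : LatPeriodic d L γ f)
    (e : EuclideanSpace ℝ (Fin d)) : LatPeriodic d L γ (fun x => fderiv ℝ f x e) := by
  intro x i
  have : (fun x => f (x + latVec d L γ i)) = f := funext fun x => hf x i
  simp only
  rw [← fderiv_comp_add_right, this]

lemma energy (hL : 0 < L) (hγ : ∀ i, 1 ≤ γ i) {V : EuclideanSpace ℝ (Fin d) → ℝ}
    (hV : ∀ x, 0 ≤ V x) {E : ℝ} {Ψ : EuclideanSpace ℝ (Fin d) → ℂ}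
    (hΨ : IsSolution d L γ V E Ψ) (j : Fin d) :
    ∫ x in fund d L γ, ‖fderiv ℝ Ψ x (EuclideanSpace.single j 1)‖ ^ 2 ≤ E := by
  obtain ⟨hC, hper, heq, hn⟩ := hΨ
  have hD : ∀ i : Fin d, ContDiff ℝ 1 (fun y => fderiv ℝ Ψ y (EuclideanSpace.single i 1)) :=
    fun i => (hC.fderiv_right (m := 1) (by norm_num)).clm_apply contDiff_const
  let F : Fin d → EuclideanSpace ℝ (Fin d) → ℝ := fun i x =>
    inner ℝ (Ψ x) (fderiv ℝ Ψ x (EuclideanSpace.single i 1))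
  have hFC : ∀ i, ContDiff ℝ 1 (F i) := fun i =>
    (hC.of_le (by norm_num)).inner ℝ (hD i)
  have hFp : ∀ i, LatPeriodic d L γ (F i) := by
    intro i x k
    have := per_fderiv hper (EuclideanSpace.single i 1) x k
    simp only [F] at this ⊢
    rw [this, hper x k]
  have hz : ∀ i, ∫ x in fund d L γ, fderiv ℝ (F i) x (EuclideanSpace.single i 1) = 0 :=
    fun i => int_deriv hL hγ (hFC i) (hFp i) _ (per_fderiv (hFp i) _)
  have hdF : ∀ i x, fderiv ℝ (F i) x (EuclideanSpace.single i 1) =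
      inner ℝ (Ψ x) (fderiv ℝ (fun y => fderiv ℝ Ψ y (EuclideanSpace.single i 1)) x
      (EuclideanSpace.single i 1)) + ‖fderiv ℝ Ψ x (EuclideanSpace.single i 1)‖ ^ 2 := by
    intro i x
    simp only [F]
    rw [fderiv_inner_apply ℝ (hC.differentiable (by norm_num) x)
      ((hD i).differentiable (by norm_num) x), real_inner_self_eq_norm_sq]
  have hpt : ∀ x, ∑ i, ‖fderiv ℝ Ψ x (EuclideanSpace.single i 1)‖ ^ 2
      ≤ E * ‖Ψ x‖ ^ 2 + ∑ i, fderiv ℝ (F i) x (EuclideanSpace.single i 1) := by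
    intro x
    simp_rw [hdF]
    rw [Finset.sum_add_distrib, ← inner_sum]
    have h1 := heq x
    change _ ≤ _ + (inner ℝ (Ψ x) (lap d Ψ x) + _)
    have h2 : lap d Ψ x = (V x - E) • Ψ x := by
      rw [Complex.real_smul]; push_cast; linear_combination -h1
    rw [h2, inner_smul_right, real_inner_self_eq_norm_sq]
    nlinarith [mul_nonneg (hV x) (sq_nonneg ‖Ψ x‖)]
  have hcD : ∀ i, Continuous fun x => ‖fderiv ℝ Ψ x (EuclideanSpace.single i 1)‖ ^ 2 :=
    fun i => ((hD i).continuous.norm).pow 2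
  have hcF : ∀ i, Continuous fun x => fderiv ℝ (F i) x (EuclideanSpace.single i 1) := fun i =>
    ((hFC i).continuous_fderiv (by norm_num)).clm_apply continuous_const
  have hcΨ : Continuous fun x => E * ‖Ψ x‖ ^ 2 := (hC.continuous.norm.pow 2).const_mul E
  calc ∫ x in fund d L γ, ‖fderiv ℝ Ψ x (EuclideanSpace.single j 1)‖ ^ 2
      ≤ ∫ x in fund d L γ, (E * ‖Ψ x‖ ^ 2 +
        ∑ i, fderiv ℝ (F i) x (EuclideanSpace.single i 1)) := by
        refine integral_mono (cont_int hL hγ (hcD j)) (cont_int hL hγ ?_) ?_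
        · exact hcΨ.add (continuous_finsetSum _ fun i _ => hcF i)
        · intro x
          refine le_trans ?_ (hpt x)
          exact Finset.single_le_sum
            (f := fun i => ‖fderiv ℝ Ψ x (EuclideanSpace.single i 1)‖ ^ 2)
            (fun i _ => sq_nonneg _) (Finset.mem_univ j)
    _ = E := by
        rw [integral_add (cont_int hL hγ hcΨ)
          (cont_int hL hγ (continuous_finsetSum _ fun i _ => hcF i)),
          integral_finsetSum _ (fun i _ => cont_int hL hγ (hcF i)), integral_const_mul, hn]
        simp [hz]

lemma cs_aux {u : ℝ → ℝ} (hu : Continuous u) {h : ℝ} (hh : 0 < h) :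
    (∫ s in (0:ℝ)..h, u s) ^ 2 ≤ h * ∫ s in (0:ℝ)..h, u s ^ 2 := by
  set m := ∫ s in (0:ℝ)..h, u s with hm
  have h0 : 0 ≤ ∫ s in (0:ℝ)..h, (h * u s - m) ^ 2 :=
    intervalIntegral.integral_nonneg hh.le fun _ _ => sq_nonneg _
  have h1 : ∀ s, (h * u s - m) ^ 2 = h ^ 2 * u s ^ 2 - 2 * h * m * u s + m ^ 2 := fun s => by ring
  simp_rw [h1] at h0
  have i1 : IntervalIntegrable (fun s => h ^ 2 * u s ^ 2) volume 0 h :=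
    (by fun_prop : Continuous fun s => h ^ 2 * u s ^ 2).intervalIntegrable _ _
  have i2 : IntervalIntegrable (fun s => 2 * h * m * u s) volume 0 h :=
    (by fun_prop : Continuous fun s => 2 * h * m * u s).intervalIntegrable _ _
  rw [intervalIntegral.integral_add (i1.sub i2) intervalIntegrable_const,
    intervalIntegral.integral_sub i1 i2, intervalIntegral.integral_const_mul,
    intervalIntegral.integral_const_mul, ← hm, intervalIntegral.integral_const] at h0
  simp only [sub_zero, smul_eq_mul] at h0
  have : 0 ≤ h * (h * (∫ s in (0:ℝ)..h, u s ^ 2) - m ^ 2) := by nlinarith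
  have := nonneg_of_mul_nonneg_right this hh
  linarith

lemma trans_est (hL : 0 < L) (hγ : ∀ i, 1 ≤ γ i) {V : EuclideanSpace ℝ (Fin d) → ℝ}
    (hV : ∀ x, 0 ≤ V x) {E : ℝ} {Ψ : EuclideanSpace ℝ (Fin d) → ℂ}
    (hΨ : IsSolution d L γ V E Ψ) (j : Fin d) {h : ℝ} (hh : 0 < h) :
    ∫ x in fund d L γ, ‖Ψ (x + h • EuclideanSpace.single j 1) - Ψ x‖ ^ 2 ≤ h ^ 2 * E := by
  have hen := energy hL hγ hV hΨ j
  obtain ⟨hC, hper, heq, hn⟩ := hΨ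
  set e : EuclideanSpace ℝ (Fin d) := EuclideanSpace.single j 1
  have hc : Continuous (fun x => fderiv ℝ Ψ x e) :=
    (hC.continuous_fderiv (by norm_num)).clm_apply continuous_const
  have h2 : ∀ x, ∫ s in (0:ℝ)..h, fderiv ℝ Ψ (x + s • e) e = Ψ (x + h • e) - Ψ x := by
    intro x
    have := intervalIntegral.integral_eq_sub_of_hasDerivAt (a := 0) (b := h)
      (f := fun s : ℝ => Ψ (x + s • e)) (f' := fun s => fderiv ℝ Ψ (x + s • e) e) ?_ ?_
    · simpa using this
    · intro s _
      have h3 : HasDerivAt (fun s : ℝ => x + s • e) e s := by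
        simpa using ((hasDerivAt_id s).smul_const e).const_add x
      exact ((hC.differentiable (by norm_num)) _).hasFDerivAt.comp_hasDerivAt s h3
    · exact (hc.comp (by fun_prop : Continuous fun s : ℝ => x + s • e)).intervalIntegrable _ _
  have hf := fub hL hγ (g := fun x => ‖fderiv ℝ Ψ x e‖ ^ 2) (hc.norm.pow 2) (by
    intro x i
    have := per_fderiv hper e x i
    simp only at this ⊢
    rw [this]) e h
  have hpt : ∀ x, ‖Ψ (x + h • e) - Ψ x‖ ^ 2 ≤
      h * ∫ s in (0:ℝ)..h, ‖fderiv ℝ Ψ (x + s • e) e‖ ^ 2 := by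
    intro x
    rw [← h2 x]
    refine le_trans ?_ (cs_aux (u := fun s => ‖fderiv ℝ Ψ (x + s • e) e‖)
      (hc.comp (by fun_prop : Continuous fun s : ℝ => x + s • e)).norm hh)
    gcongr
    exact intervalIntegral.norm_integral_le_integral_norm hh.le
  calc _ ≤ ∫ x in fund d L γ, h * ∫ s in (0:ℝ)..h, ‖fderiv ℝ Ψ (x + s • e) e‖ ^ 2 := by
        refine integral_mono (cont_int hL hγ ?_) (cont_int hL hγ ?_) hpt
        · exact ((hC.continuous.comp (by fun_prop : Continuous fun x => x + h • e)).sub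
            hC.continuous).norm.pow 2
        · refine continuous_const.mul ?_
          refine intervalIntegral.continuous_parametric_intervalIntegral_of_continuous'
            (f := fun x s => ‖fderiv ℝ Ψ (x + s • e) e‖ ^ 2) ?_ 0 h
          unfold Function.uncurry
          exact (hc.comp (by fun_prop : Continuous fun
            p : EuclideanSpace ℝ (Fin d) × ℝ => p.1 + p.2 • e)).norm.pow 2
    _ ≤ h ^ 2 * E := by
        rw [integral_const_mul, hf]
        nlinarith [mul_le_mul_of_nonneg_left hen (sq_nonneg h)]

def slab (d : ℕ) (L : ℝ) (j : Fin d) (ρ a : ℝ) : Set (EuclideanSpace ℝ (Fin d)) :=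
  {x | ∃ k : ℤ, |x j - a - k * L| < ρ}

lemma slab_meas (j : Fin d) (ρ a : ℝ) : MeasurableSet (slab d L j ρ a) := by
  have : slab d L j ρ a = ⋃ k : ℤ, {x : EuclideanSpace ℝ (Fin d) | |x j - a - k * L| < ρ} := by
    ext x; simp [slab]
  rw [this]
  refine MeasurableSet.iUnion fun k => IsOpen.measurableSet ?_
  exact isOpen_lt (by fun_prop) continuous_const

def sw (d : ℕ) (L : ℝ) (j : Fin d) (ρ a : ℝ) : EuclideanSpace ℝ (Fin d) → ℝ :=
  (slab d L j ρ a).indicator 1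

lemma sw_per (j : Fin d) (hj : γ j = 1) (ρ a : ℝ) : LatPeriodic d L γ (sw d L j ρ a) := by
  intro x i
  have : x + latVec d L γ i ∈ slab d L j ρ a ↔ x ∈ slab d L j ρ a := by
    by_cases hij : j = i
    · subst hij
      constructor
      · rintro ⟨k, hk⟩
        refine ⟨k - 1, ?_⟩
        convert hk using 2
        simp [latVec, hj]
        ring
      · rintro ⟨k, hk⟩
        refine ⟨k + 1, ?_⟩
        convert hk using 2
        simp [latVec, hj]
        ring
    · simp [slab, latVec, hij]
  by_cases hx : x ∈ slab d L j ρ a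
  · simp [sw, hx, this]
  · simp [sw, hx, this]

lemma sw_shift (j : Fin d) (ρ a h : ℝ) (x : EuclideanSpace ℝ (Fin d)) :
    sw d L j ρ (a + h) (x + h • EuclideanSpace.single j 1) = sw d L j ρ a x := by
  have : x + h • EuclideanSpace.single j 1 ∈ slab d L j ρ (a + h) ↔ x ∈ slab d L j ρ a := by
    simp [slab]
  by_cases hx : x ∈ slab d L j ρ a
  · simp [sw, hx, this]
  · simp [sw, hx, this]

lemma sw_disj (j : Fin d) {ρ : ℝ} (a : ℝ) (hρ : 0 < ρ) (hρL : 6 * ρ ≤ L) {h : ℝ} (h1 : 2 * ρ ≤ h)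
    (h2 : h ≤ 4 * ρ) (x : EuclideanSpace ℝ (Fin d)) (hx : x ∈ slab d L j ρ a) :
    x ∉ slab d L j ρ (a + h) := by
  rintro ⟨k', hk'⟩
  obtain ⟨k, hk⟩ := hx
  rw [abs_lt] at hk hk'
  rcases lt_trichotomy k k' with hlt | heq | hgt
  · have : (k : ℝ) + 1 ≤ k' := by exact_mod_cast hlt
    nlinarith
  · subst heq
    linarith
  · have : (k' : ℝ) + 1 ≤ k := by exact_mod_cast hgt
    nlinarith

lemma sw_sum (j : Fin d) {ρ : ℝ} (a : ℝ) (hρ : 0 < ρ) (hρL : 6 * ρ ≤ L)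
    (x : EuclideanSpace ℝ (Fin d)) :
    sw d L j ρ a x + sw d L j ρ (a + 2 * ρ) x + sw d L j ρ (a + 4 * ρ) x ≤ 1 := by
  have h1 := sw_disj j a hρ hρL (h := 2 * ρ) le_rfl (by linarith) x
  have h2 := sw_disj j a hρ hρL (h := 4 * ρ) (by linarith) le_rfl x
  have h3 := sw_disj j (a + 2 * ρ) hρ hρL (h := 2 * ρ) le_rfl (by linarith) x
  rw [show a + 2 * ρ + 2 * ρ = a + 4 * ρ by ring] at h3
  by_cases hx : x ∈ slab d L j ρ a
  · simp [sw, hx, h1 hx, h2 hx]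
  · by_cases hx' : x ∈ slab d L j ρ (a + 2 * ρ)
    · simp [sw, hx, hx', h3 hx']
    · by_cases hx'' : x ∈ slab d L j ρ (a + 4 * ρ)
      · simp [sw, hx, hx', hx'']
      · simp [sw, hx, hx', hx'']

lemma sw_int (hL : 0 < L) (hγ : ∀ i, 1 ≤ γ i) (j : Fin d) (ρ a : ℝ)
    {f : EuclideanSpace ℝ (Fin d) → ℝ} (hf : Continuous f) :
    IntegrableOn (fun x => sw d L j ρ a x * f x) (fund d L γ) := by
  have := (cont_int hL hγ hf).indicator (slab_meas (L := L) j ρ a)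
  refine this.congr (Eventually.of_forall fun x => ?_)
  by_cases hx : x ∈ slab d L j ρ a
  · simp [sw, hx]
  · simp [sw, hx]

lemma sw_nonneg (j : Fin d) (ρ a : ℝ) (x : EuclideanSpace ℝ (Fin d)) :
    0 ≤ sw d L j ρ a x ∧ sw d L j ρ a x ≤ 1 := by
  by_cases hx : x ∈ slab d L j ρ a
  · simp [sw, hx]
  · simp [sw, hx]

lemma slab_step (hL : 0 < L) (hγ : ∀ i, 1 ≤ γ i) {V : EuclideanSpace ℝ (Fin d) → ℝ}
    (hV : ∀ x, 0 ≤ V x) {E : ℝ} {Ψ : EuclideanSpace ℝ (Fin d) → ℂ}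
    (hΨ : IsSolution d L γ V E Ψ) (j : Fin d) (hj : γ j = 1) (ρ a : ℝ) {h : ℝ} (hh : 0 < h) :
    ∫ x in fund d L γ, sw d L j ρ a x * ‖Ψ x‖ ^ 2 ≤
      3 / 2 * (∫ x in fund d L γ, sw d L j ρ (a + h) x * ‖Ψ x‖ ^ 2) + 3 * (h ^ 2 * E) := by
  have ht := trans_est hL hγ hV hΨ j hh
  obtain ⟨hC, hper, heq, hn⟩ := hΨ
  have hc : Continuous fun x => ‖Ψ x‖ ^ 2 := hC.continuous.norm.pow 2
  have hcs : Continuous fun x => Ψ (x + h • EuclideanSpace.single j 1) :=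
    hC.continuous.comp (by fun_prop)
  have hcs2 : Continuous fun x => ‖Ψ (x + h • EuclideanSpace.single j 1)‖ ^ 2 := hcs.norm.pow 2
  have hcd : Continuous fun x => ‖Ψ (x + h • EuclideanSpace.single j 1) - Ψ x‖ ^ 2 :=
    (hcs.sub hC.continuous).norm.pow 2
  have hP : LatPeriodic d L γ (fun x => sw d L j ρ (a + h) x * ‖Ψ x‖ ^ 2) := by
    intro x i
    simp only
    rw [sw_per j hj ρ (a + h) x i, hper x i]
  have h1 := int_translate hL hγ hP (h • EuclideanSpace.single j 1)
  simp only [sw_shift] at h1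
  rw [← h1]
  calc _ ≤ ∫ x in fund d L γ,
        (3 / 2 * (sw d L j ρ a x * ‖Ψ (x + h • EuclideanSpace.single j 1)‖ ^ 2)
        + 3 * ‖Ψ (x + h • EuclideanSpace.single j 1) - Ψ x‖ ^ 2) := by
        refine integral_mono (sw_int hL hγ j ρ a hc)
          (((sw_int hL hγ j ρ a hcs2).const_mul _).add ((cont_int hL hγ hcd).const_mul _)) ?_
        intro x
        simp only
        obtain ⟨w0, w1⟩ := sw_nonneg (L := L) j ρ a x
        generalize sw d L j ρ a x = w at w0 w1
        generalize Ψ (x + h • EuclideanSpace.single j 1) = p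
        generalize Ψ x = q
        have ht : ‖q‖ ≤ ‖p‖ + ‖p - q‖ := by
          have := norm_sub_le p (p - q)
          simpa using this
        have h0 := norm_nonneg q
        have h0' := norm_nonneg p
        have h0'' := norm_nonneg (p - q)
        generalize ‖p - q‖ = r at *
        have hq : ‖q‖ ^ 2 ≤ 3 / 2 * ‖p‖ ^ 2 + 3 * r ^ 2 := by
          have : ‖q‖ ^ 2 ≤ (‖p‖ + r) ^ 2 := by gcongr
          nlinarith [sq_nonneg (‖p‖ - 2 * r)]
        have := mul_le_mul_of_nonneg_left hq w0
        nlinarith [mul_nonneg (sub_nonneg.2 w1) (sq_nonneg r)]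
    _ ≤ _ := by
        rw [integral_add ((sw_int hL hγ j ρ a hcs2).const_mul _)
          ((cont_int hL hγ hcd).const_mul _), integral_const_mul, integral_const_mul]
        linarith

lemma slab_key (hL : 0 < L) (hγ : ∀ i, 1 ≤ γ i) {V : EuclideanSpace ℝ (Fin d) → ℝ}
    (hV : ∀ x, 0 ≤ V x) {E : ℝ} {Ψ : EuclideanSpace ℝ (Fin d) → ℂ}
    (hΨ : IsSolution d L γ V E Ψ) (j : Fin d) (hj : γ j = 1) {ρ : ℝ} (a : ℝ) (hρ : 0 < ρ)
    (hρL : 6 * ρ ≤ L)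
    (hm : 1 / 2 ≤ ∫ x in fund d L γ, sw d L j ρ a x * ‖Ψ x‖ ^ 2) : 1 ≤ 240 * (ρ ^ 2 * E) := by
  have h1 := slab_step hL hγ hV hΨ j hj ρ a (h := 2 * ρ) (by linarith)
  have h2 := slab_step hL hγ hV hΨ j hj ρ a (h := 4 * ρ) (by linarith)
  obtain ⟨hC, hper, heq, hn⟩ := hΨ
  have hc : Continuous fun x => ‖Ψ x‖ ^ 2 := hC.continuous.norm.pow 2
  have h3 : (∫ x in fund d L γ, sw d L j ρ a x * ‖Ψ x‖ ^ 2) +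
      (∫ x in fund d L γ, sw d L j ρ (a + 2 * ρ) x * ‖Ψ x‖ ^ 2) +
      (∫ x in fund d L γ, sw d L j ρ (a + 4 * ρ) x * ‖Ψ x‖ ^ 2) ≤ 1 := by
    have i0 := sw_int hL hγ j ρ a hc
    have i1 := sw_int hL hγ j ρ (a + 2 * ρ) hc
    have i2 := sw_int hL hγ j ρ (a + 4 * ρ) hc
    have i01 : IntegrableOn (fun x => sw d L j ρ a x * ‖Ψ x‖ ^ 2 +
      sw d L j ρ (a + 2 * ρ) x * ‖Ψ x‖ ^ 2) (fund d L γ) := i0.add i1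
    rw [← integral_add i0 i1, ← integral_add i01 i2, ← hn]
    refine integral_mono (i01.add i2) (cont_int hL hγ hc) fun x => ?_
    have := mul_le_mul_of_nonneg_right (sw_sum j a hρ hρL x) (sq_nonneg ‖Ψ x‖)
    simp only
    linarith
  nlinarith

lemma tball_sub_slab (j : Fin d) (hj : γ j = 1) (x₀ : EuclideanSpace ℝ (Fin d)) (ρ : ℝ) :
    torusBall d L γ x₀ ρ ⊆ slab d L j ρ (x₀ j) := by
  intro x hx
  obtain ⟨v, hv⟩ := exists_lt_of_ciInf_lt (show torusDist d L γ x x₀ < ρ from hx)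
  refine ⟨v j, lt_of_le_of_lt ?_ hv⟩
  have := PiLp.norm_apply_le (x - x₀ - ∑ i, (v i : ℝ) • latVec d L γ i) j
  rw [Real.norm_eq_abs] at this
  have he : (x - x₀ - ∑ i, (v i : ℝ) • latVec d L γ i) j = x j - x₀ j - v j * L := by
    have hs : (∑ i, (v i : ℝ) • latVec d L γ i) j = ∑ i, ((v i : ℝ) • latVec d L γ i) j := by
      simp
    rw [PiLp.sub_apply, PiLp.sub_apply, hs, Finset.sum_eq_single j]
    · simp [latVec, hj]
    · intro i _ hi
      simp [latVec, hi.symm]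
    · simp
  rwa [he] at this

lemma loc_key (hL : 0 < L) (hγ : ∀ i, 1 ≤ γ i) {V : EuclideanSpace ℝ (Fin d) → ℝ}
    (hV : ∀ x, 0 ≤ V x) {E : ℝ} {Ψ : EuclideanSpace ℝ (Fin d) → ℂ}
    (hΨ : IsSolution d L γ V E Ψ) (j : Fin d) (hj : γ j = 1) {ρ : ℝ} (hρ : 0 < ρ)
    (hρL : 6 * ρ ≤ L) (x₀ : EuclideanSpace ℝ (Fin d))
    (hm : ∫ x in fund d L γ \ torusBall d L γ x₀ ρ, ‖Ψ x‖ ^ 2 ≤ 1 / 2) :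
    1 ≤ 240 * (ρ ^ 2 * E) := by
  refine slab_key hL hγ hV hΨ j hj (x₀ j) hρ hρL ?_
  obtain ⟨hC, hper, heq, hn⟩ := hΨ
  have hc : Continuous fun x => ‖Ψ x‖ ^ 2 := hC.continuous.norm.pow 2
  have hI := cont_int hL hγ hc
  have h1 : ∫ x in fund d L γ \ slab d L j ρ (x₀ j), ‖Ψ x‖ ^ 2 ≤ 1 / 2 := by
    refine le_trans ?_ hm
    refine setIntegral_mono_set (hI.mono_set Set.sdiff_subset)
      (Eventually.of_forall fun x => sq_nonneg _) ?_
    exact (Set.sdiff_subset_sdiff_right (tball_sub_slab j hj x₀ ρ)).eventuallyLE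
  have h2 := integral_inter_add_sdiff (slab_meas (L := L) j ρ (x₀ j)) hI
  have h3 : ∫ x in fund d L γ, sw d L j ρ (x₀ j) x * ‖Ψ x‖ ^ 2 =
      ∫ x in fund d L γ ∩ slab d L j ρ (x₀ j), ‖Ψ x‖ ^ 2 := by
    rw [← setIntegral_indicator (slab_meas (L := L) j ρ (x₀ j))]
    congr 1
    ext x
    by_cases hx : x ∈ slab d L j ρ (x₀ j)
    · simp [sw, hx]
    · simp [sw, hx]
  rw [h3]
  linarith

lemma tends_aux {cV a b B : ℝ} (hc : 0 < cV) (hB : 0 < B) (ha : a < 0) (hab : a + b < 0) :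
    Filter.Tendsto (fun E' : ℝ => cV * E' ^ a * min 1 (B * E' ^ b))
      (nhdsWithin 0 (Set.Ioi 0)) Filter.atTop := by
  have h1 := (tendsto_rpow_neg_nhdsGT_zero ha).const_mul_atTop hc
  have h2 := (tendsto_rpow_neg_nhdsGT_zero hab).const_mul_atTop (mul_pos hc hB)
  rw [tendsto_atTop] at *
  intro M
  filter_upwards [h1 M, h2 M, self_mem_nhdsWithin] with x hx1 hx2 hx
  have hx : 0 < x := hx
  rw [mul_min_of_nonneg _ _ (by positivity), mul_one]
  refine le_min hx1 (hx2.trans_eq ?_)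
  rw [rpow_add hx]; ring

end helpers

/-- **Blow-up of localization length for algebraic decay** (Section 2.2.2): with the
absolute constants and energy conditions of the algebraic delocalization theorem, if `Ψ`
is localized with respect to `x₀` with localization length `ℓ_loc` and algebraic decay
`δ(r) = C r^{-α}` (`C ≥ 1/2`, `α > 0`, with `δ` taking values in `[0,1/2]` on `[1,∞)`),
then `ℓ_loc > c_V E^{-1/4+η(1-d/4)} · min(1, C^{-1/α} E^{-η+1/α})`; moreover if
`α > 4/(1+dη)` this lower bound tends to `+∞` as `E → 0⁺`. -/
theorem localization_length_lower_bound_algebraic :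
    ∃ c₁ c₂ : ℝ, 0 < c₁ ∧ 0 < c₂ ∧
      ∀ (d : ℕ) (hd : 0 < d), d ≤ 3 →
      ∀ γ : Fin d → ℝ, (∀ i, 1 ≤ γ i) → γ ⟨0, hd⟩ = 1 →
      ∀ η : ℝ, 0 < η → η < 1 / (4 - (d : ℝ)) →
      ∀ Vsup : ℝ, 0 ≤ Vsup →
      ∀ cV : ℝ, cV = c₁ * (1 + Vsup ^ ((1:ℝ)/2)) ^ (-(1:ℝ)/2) →
      ∃ L₀ : ℝ, 0 < L₀ ∧ ∀ L : ℝ, L₀ ≤ L →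
      ∀ V : EuclideanSpace ℝ (Fin d) → ℝ,
        Measurable V → (∀ x, 0 ≤ V x) → (∀ x, V x ≤ Vsup) → LatPeriodic d L γ V →
      ∀ E : ℝ, 0 < E → E < 1 →
        (2 * cV / L) ^ ((4:ℝ) / (1 + d * η)) ≤ E →
        E ≤ min (cV ^ ((4:ℝ) / (1 + d * η))) (c₂ ^ ((2:ℝ) / (d * η))) →
      ∀ Ψ : EuclideanSpace ℝ (Fin d) → ℂ, IsSolution d L γ V E Ψ →
      ∀ (x₀ : EuclideanSpace ℝ (Fin d)) (ℓloc : ℝ), 0 < ℓloc →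
      ∀ C α : ℝ, 1 / 2 ≤ C → 0 < α →
        (∀ r, 1 ≤ r → C * r ^ (-α) ∈ Set.Icc 0 (1/2)) →
        (∀ r, ℓloc ≤ r →
          (∫ x in fund d L γ \ torusBall d L γ x₀ r, ‖Ψ x‖ ^ 2) ≤ C * (r / ℓloc) ^ (-α)) →
        ℓloc > cV * E ^ (-(1:ℝ)/4 + η * (1 - (d:ℝ)/4)) *
            min 1 (C ^ (-(1:ℝ)/α) * E ^ (-η + 1/α)) ∧
        ((4:ℝ) / (1 + d * η) < α →
          Filter.Tendsto
            (fun E' : ℝ => cV * E' ^ (-(1:ℝ)/4 + η * (1 - (d:ℝ)/4)) *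
              min 1 (C ^ (-(1:ℝ)/α) * E' ^ (-η + 1/α)))
            (nhdsWithin 0 (Set.Ioi 0)) Filter.atTop) := by
  refine ⟨1 / 16, 1 / 9, by norm_num, by norm_num, ?_⟩
  intro d hd hd3 γ hγ hγ0 η hη hη' Vsup hVs cV hcV
  have hd1 : (1 : ℝ) ≤ d := by exact_mod_cast hd
  have hd3' : (d : ℝ) ≤ 3 := by exact_mod_cast hd3
  have hB1 : (1 : ℝ) ≤ 1 + Vsup ^ ((1:ℝ)/2) := by
    have := rpow_nonneg hVs ((1:ℝ)/2)
    linarith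
  have hcVpos : 0 < cV := by
    rw [hcV]; positivity
  have hcVle : cV ≤ 1 / 16 := by
    rw [hcV]
    have := rpow_le_one_of_one_le_of_nonpos hB1 (by norm_num : -(1:ℝ)/2 ≤ 0)
    linarith
  have hη4 : η * (4 - d) < 1 := by
    rwa [lt_div_iff₀ (by linarith)] at hη'
  have ha : -(1:ℝ)/4 + η * (1 - (d:ℝ)/4) < 0 := by linarith
  have hdη : 0 < d * η := by positivity
  refine ⟨1, one_pos, ?_⟩
  intro L hL1 V _ hV0 _ _ E hE0 hE1 hElow hEup Ψ hΨ x₀ ℓ hℓ C α hC hα hdec hloc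
  have hL : 0 < L := by linarith
  have hCpos : 0 < C := by linarith
  refine ⟨?_, fun hα' => ?_⟩
  · set ρ := cV * E ^ (-(1:ℝ)/4 + η * (1 - (d:ℝ)/4)) with hρdef
    have hρ : 0 < ρ := by positivity
    suffices h : ρ < ℓ by
      refine lt_of_le_of_lt ?_ h
      have := mul_le_mul_of_nonneg_left
        (min_le_left 1 (C ^ (-(1:ℝ)/α) * E ^ (-η + 1/α))) hρ.le
      linarith
    by_contra hcon
    have hcon : ℓ ≤ ρ := not_lt.1 hcon
    have hm := (hloc ρ hcon).trans (hdec (ρ / ℓ) ((one_le_div hℓ).2 hcon)).2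
    have hEη : E ^ η ≤ 1 / 3 := by
      have h1 := hEup.trans (min_le_right _ _)
      have h2 := rpow_le_rpow hE0.le h1 hη.le
      rw [← rpow_mul (by norm_num)] at h2
      refine h2.trans ?_
      have h3 : (1:ℝ) / 2 ≤ 2 / (d * η) * η := by
        rw [div_mul_eq_mul_div, div_le_div_iff₀ (by norm_num) hdη]
        nlinarith
      refine (rpow_le_rpow_of_exponent_ge (by norm_num) (by norm_num) h3).trans ?_
      rw [← sqrt_eq_rpow, show (1:ℝ) / 9 = (1 / 3) ^ 2 by norm_num, sqrt_sq (by norm_num)]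
    have hLow : 2 * cV ≤ L * E ^ ((1 + d * η) / 4) := by
      have h1 := rpow_le_rpow (by positivity) hElow
        (by positivity : 0 ≤ (1 + d * η) / 4)
      rw [← rpow_mul (by positivity), show (4:ℝ) / (1 + d * η) * ((1 + d * η) / 4) = 1 by
        field_simp, rpow_one, div_le_iff₀ hL] at h1
      linarith
    have hρL : 6 * ρ ≤ L := by
      have h1 : E ^ (-(1:ℝ)/4 + η * (1 - (d:ℝ)/4)) * E ^ ((1 + d * η) / 4) = E ^ η := by
        rw [← rpow_add hE0]; congr 1; ring
      have h2 := mul_le_mul_of_nonneg_left hLow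
        (rpow_nonneg hE0.le (-(1:ℝ)/4 + η * (1 - (d:ℝ)/4)))
      have h3 : 2 * ρ ≤ L * E ^ η := by
        rw [← h1, hρdef]; linarith
      nlinarith
    have hkey := loc_key hL hγ hV0 hΨ ⟨0, hd⟩ hγ0 hρ hρL x₀ hm
    have h4 : ρ ^ 2 * E ≤ cV ^ 2 := by
      have h5 : (E ^ (-(1:ℝ)/4 + η * (1 - (d:ℝ)/4))) ^ 2 * E
          = E ^ (2 * (-(1:ℝ)/4 + η * (1 - (d:ℝ)/4)) + 1) := by
        rw [rpow_add hE0 (2 * _) 1, rpow_one, mul_comm (2:ℝ), rpow_mul hE0.le, rpow_two]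
      have h6 : E ^ (2 * (-(1:ℝ)/4 + η * (1 - (d:ℝ)/4)) + 1) ≤ 1 := by
        refine rpow_le_one hE0.le hE1.le ?_
        have : 0 ≤ η * (1 - (d:ℝ)/4) := mul_nonneg hη.le (by linarith)
        linarith
      rw [← h5] at h6
      rw [hρdef, mul_pow, mul_assoc]
      exact mul_le_of_le_one_right (sq_nonneg _) h6
    nlinarith
  · refine tends_aux hcVpos (by positivity) ha ?_
    have : 1 / α < (1 + d * η) / 4 := by
      rw [div_lt_div_iff₀ hα (by norm_num)]
      rw [div_lt_iff₀ (by positivity)] at hα'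
      linarith
    linarith
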